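/- Let G = (V, E) be a cubic simple graph with n = |V| and let H = f(G). For every control matching M of H containing no pair of mutually reverse arcs, OPT(H) − w(M) ≥ α(G) − |V_3(M)|, where OPT(H) is the maximum weight of a control matching of H containing no pair of mutually reverse arcs, α(G) is the independence number of G, and V_3(M) is the set of vertices u ∈ V all three of whose associated edge-arcs lie in M. -/

import Mathlib

/-! Construction `H = f(G)` from the APX-hardness reduction.  `G` is a cubic simple
graph on `V` with a fixed ordering `nbr u 0, nbr u 1, nbr u 2` of the neighbors of each
vertex `u`.  The vertices of `H` are the tokens `t_{uv}`, encoded as ordered pairs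
`(u, v) : V × V` (only pairs with `G.Adj u v` occur in arcs).  An arc of `H` is an
ordered pair of such tokens. -/

/-- An arc of `H`: an ordered pair of tokens `t_{uv}`. -/
abbrev Arc (V : Type*) := (V × V) × (V × V)

/-- The edge-arc `(t_{uv}, t_{vu})` associated with `u`, for the edge `{u, v}`. -/
def edgeArc {V : Type*} (u v : V) : Arc V := ((u, v), (v, u))

/-- The first node-arc `(t_{u v1}, t_{v2 u})` associated with `u`. -/
def nodeArc1 {V : Type*} (nbr : V → Fin 3 → V) (u : V) : Arc V :=
  ((u, nbr u 0), (nbr u 1, u))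

/-- The second node-arc `(t_{u v2}, t_{v3 u})` associated with `u`. -/
def nodeArc2 {V : Type*} (nbr : V → Fin 3 → V) (u : V) : Arc V :=
  ((u, nbr u 1), (nbr u 2, u))

/-- `a` is an edge-arc of `H`, i.e. `a = (t_{uv}, t_{vu})` for some edge `{u, v}` of `G`. -/
def IsEdgeArc {V : Type*} (G : SimpleGraph V) (a : Arc V) : Prop :=
  G.Adj a.1.1 a.1.2 ∧ a.2 = (a.1.2, a.1.1)

/-- `a` is a node-arc of `H`. -/
def IsNodeArc {V : Type*} (nbr : V → Fin 3 → V) (a : Arc V) : Prop :=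
  ∃ u, a = nodeArc1 nbr u ∨ a = nodeArc2 nbr u

/-- `a` is an arc of `H = f(G)`: an edge-arc (weight 1), a node-arc (weight 1), or the
reverse of a node-arc (weight 0). -/
def IsArcH {V : Type*} (G : SimpleGraph V) (nbr : V → Fin 3 → V) (a : Arc V) : Prop :=
  IsEdgeArc G a ∨ IsNodeArc nbr a ∨ IsNodeArc nbr (Prod.swap a)

/-- A control matching of `H`: a set of arcs of `H` such that each vertex of `H` is the
head of at most one arc in `M` and the tail of at most one arc in `M`. -/
def IsControlMatching {V : Type*} (G : SimpleGraph V) (nbr : V → Fin 3 → V)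
    (M : Finset (Arc V)) : Prop :=
  (∀ a ∈ M, IsArcH G nbr a) ∧
  (∀ a ∈ M, ∀ b ∈ M, a.1 = b.1 → a = b) ∧
  (∀ a ∈ M, ∀ b ∈ M, a.2 = b.2 → a = b)

/-- `M` contains no pair of mutually reverse arcs. -/
def NoReversePair {V : Type*} (M : Finset (Arc V)) : Prop :=
  ∀ a ∈ M, Prod.swap a ∉ M

open scoped Classical in
/-- The weight of `M`: edge-arcs and node-arcs have weight 1, all other arcs (the
reverses of node-arcs) have weight 0, so `w(M)` is the number of edge- and node-arcs
in `M`. -/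
noncomputable def weightM {V : Type*} (G : SimpleGraph V) (nbr : V → Fin 3 → V)
    (M : Finset (Arc V)) : ℕ :=
  (M.filter (fun a => IsEdgeArc G a ∨ IsNodeArc nbr a)).card

open scoped Classical in
/-- `V₃(M)`: the set of vertices `u` of `G` all three of whose associated edge-arcs lie
in `M`. -/
noncomputable def V3 {V : Type*} [Fintype V] (nbr : V → Fin 3 → V)
    (M : Finset (Arc V)) : Finset V :=
  Finset.univ.filter (fun u => ∀ i : Fin 3, edgeArc u (nbr u i) ∈ M)

/-- The five weight-1 arcs associated with the vertex `u`: its three edge-arcs and its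
two node-arcs. -/
def assocArcs {V : Type*} [DecidableEq V] (nbr : V → Fin 3 → V) (u : V) :
    Finset (Arc V) :=
  {edgeArc u (nbr u 0), edgeArc u (nbr u 1), edgeArc u (nbr u 2),
   nodeArc1 nbr u, nodeArc2 nbr u}

/-- The independence number `α(G)`. -/
noncomputable def indepNum {V : Type*} [Fintype V] (G : SimpleGraph V) : ℕ :=
  sSup {k : ℕ | ∃ S : Finset V, (∀ a ∈ S, ∀ b ∈ S, ¬ G.Adj a b) ∧ S.card = k}

/-- `OPT(H)`: the maximum weight of a control matching of `H` containing no pair of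
mutually reverse arcs. -/
noncomputable def OPT {V : Type*} (G : SimpleGraph V) (nbr : V → Fin 3 → V) : ℕ :=
  sSup {k : ℕ | ∃ M : Finset (Arc V),
    IsControlMatching G nbr M ∧ NoReversePair M ∧ weightM G nbr M = k}

/-- A set meeting `{a, b, c, d, e}` and containing no two consecutive members of the path
`a, d, b, e, c` has at most two of them, or contains all of `a, b, c`. -/
theorem card_inter_path_le {α : Type*} [DecidableEq α] (s : Finset α) (a b c d e : α)
    (had : a ∈ s → d ∉ s) (hdb : d ∈ s → b ∉ s) (hbe : b ∈ s → e ∉ s) (hec : e ∈ s → c ∉ s) :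
    (({a, b, c, d, e} : Finset α).filter (· ∈ s)).card ≤
      2 + if a ∈ s ∧ b ∈ s ∧ c ∈ s then 1 else 0 := by
  simp only [Finset.filter_insert, Finset.filter_singleton]
  have h2 : ∀ x y : α, ({x, y} : Finset α).card ≤ 2 := fun _ _ => Finset.card_le_two
  have h3 : ∀ x y z : α, ({x, y, z} : Finset α).card ≤ 3 := fun _ _ _ => Finset.card_le_three
  by_cases ha : a ∈ s <;> by_cases hb : b ∈ s <;> by_cases hc : c ∈ s <;>
    by_cases hd : d ∈ s <;> by_cases he : e ∈ s <;> simp_all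

theorem card_filter_assocArcs_le {V : Type*} [Fintype V] [DecidableEq V] {G : SimpleGraph V}
    {nbr : V → Fin 3 → V} (hinj : ∀ u : V, Function.Injective (nbr u))
    {M : Finset (Arc V)} (hM : IsControlMatching G nbr M) (u : V) :
    ((assocArcs nbr u).filter (· ∈ M)).card ≤ 2 + if u ∈ V3 nbr M then 1 else 0 := by
  have h01 : nbr u 0 ≠ nbr u 1 := (hinj u).ne (by decide)
  have h12 : nbr u 1 ≠ nbr u 2 := (hinj u).ne (by decide)
  obtain ⟨-, ht, hh⟩ := hM
  have key := card_inter_path_le M (edgeArc u (nbr u 0)) (edgeArc u (nbr u 1))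
    (edgeArc u (nbr u 2)) (nodeArc1 nbr u) (nodeArc2 nbr u)
    (fun h h' => by simpa [edgeArc, nodeArc1, h01] using ht _ h _ h' rfl)
    (fun h h' => by simpa [edgeArc, nodeArc1, h01] using hh _ h _ h' rfl)
    (fun h h' => by simpa [edgeArc, nodeArc2, h12] using ht _ h _ h' rfl)
    (fun h h' => by simpa [edgeArc, nodeArc2, h12] using hh _ h _ h' rfl)
  simpa [assocArcs, V3, Fin.forall_fin_succ] using key

theorem weightM_le {V : Type*} [Fintype V] [DecidableEq V] {G : SimpleGraph V}
    {nbr : V → Fin 3 → V} (hadj : ∀ u v : V, G.Adj u v ↔ ∃ i : Fin 3, nbr u i = v)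
    (hinj : ∀ u : V, Function.Injective (nbr u))
    {M : Finset (Arc V)} (hM : IsControlMatching G nbr M) :
    weightM G nbr M ≤ 2 * Fintype.card V + (V3 nbr M).card := by
  classical
  have hsub : M.filter (fun a => IsEdgeArc G a ∨ IsNodeArc nbr a) ⊆
      Finset.univ.biUnion (fun u => (assocArcs nbr u).filter (· ∈ M)) := by
    intro a ha
    obtain ⟨haM, ha⟩ := Finset.mem_filter.1 ha
    simp only [Finset.mem_biUnion, Finset.mem_univ, true_and, Finset.mem_filter, haM, and_true]
    rcases ha with ⟨h, h'⟩ | ⟨u, rfl | rfl⟩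
    · obtain ⟨⟨u, v⟩, b⟩ := a
      obtain rfl : b = (v, u) := h'
      obtain ⟨i, rfl⟩ := (hadj u v).1 h
      refine ⟨u, ?_⟩
      fin_cases i <;> simp [assocArcs, edgeArc]
    · exact ⟨u, by simp [assocArcs]⟩
    · exact ⟨u, by simp [assocArcs]⟩
  calc weightM G nbr M ≤ _ := by
        unfold weightM
        convert Finset.card_le_card hsub
    _ ≤ ∑ u, ((assocArcs nbr u).filter (· ∈ M)).card := Finset.card_biUnion_le
    _ ≤ ∑ u, (2 + if u ∈ V3 nbr M then 1 else 0) :=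
        Finset.sum_le_sum fun u _ => card_filter_assocArcs_le hinj hM u
    _ = 2 * Fintype.card V + (V3 nbr M).card := by
        simp [Finset.sum_add_distrib, mul_comm]

/-- The arcs chosen at `u` for the independent set `S`: all edge-arcs if `u ∈ S`, both
node-arcs otherwise. -/
def indepArcsAt {V : Type*} [DecidableEq V] (nbr : V → Fin 3 → V) (S : Finset V) (u : V) :
    Finset (Arc V) :=
  if u ∈ S then {edgeArc u (nbr u 0), edgeArc u (nbr u 1), edgeArc u (nbr u 2)}
  else {nodeArc1 nbr u, nodeArc2 nbr u}

/-- The control matching of `H` built from the independent set `S`. -/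
def indepMatching {V : Type*} [Fintype V] [DecidableEq V] (nbr : V → Fin 3 → V)
    (S : Finset V) : Finset (Arc V) :=
  Finset.univ.biUnion (indepArcsAt nbr S)

section IndepMatching

variable {V : Type*} [DecidableEq V] {G : SimpleGraph V} {nbr : V → Fin 3 → V}

theorem mem_indepArcsAt {S : Finset V} {u : V} {a : Arc V} :
    a ∈ indepArcsAt nbr S u ↔ (u ∈ S ∧ ∃ i, a = edgeArc u (nbr u i)) ∨
      (u ∉ S ∧ (a = nodeArc1 nbr u ∨ a = nodeArc2 nbr u)) := by
  by_cases h : u ∈ S <;> simp [indepArcsAt, h, Fin.exists_fin_succ]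

theorem fst_fst_of_mem_indepArcsAt {S : Finset V} {u : V} {a : Arc V}
    (h : a ∈ indepArcsAt nbr S u) : a.1.1 = u := by
  rcases mem_indepArcsAt.1 h with ⟨-, i, rfl⟩ | ⟨-, rfl | rfl⟩ <;> rfl

theorem snd_snd_of_mem_indepArcsAt {S : Finset V} {u : V} {a : Arc V}
    (h : a ∈ indepArcsAt nbr S u) : a.2.2 = u := by
  rcases mem_indepArcsAt.1 h with ⟨-, i, rfl⟩ | ⟨-, rfl | rfl⟩ <;> rfl

theorem card_indepArcsAt (hinj : ∀ u : V, Function.Injective (nbr u)) (S : Finset V) (u : V) :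
    (indepArcsAt nbr S u).card = 2 + if u ∈ S then 1 else 0 := by
  have h01 : nbr u 0 ≠ nbr u 1 := (hinj u).ne (by decide)
  have h02 : nbr u 0 ≠ nbr u 2 := (hinj u).ne (by decide)
  have h12 : nbr u 1 ≠ nbr u 2 := (hinj u).ne (by decide)
  by_cases h : u ∈ S
  · rw [indepArcsAt, if_pos h, if_pos h, Finset.card_eq_three.2]
    exact ⟨_, _, _, by simp [edgeArc, h01], by simp [edgeArc, h02], by simp [edgeArc, h12], rfl⟩
  · rw [indepArcsAt, if_neg h, if_neg h, Finset.card_pair]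
    simp [nodeArc1, nodeArc2, h01]

variable [Fintype V]

theorem mem_indepMatching {S : Finset V} {a : Arc V} :
    a ∈ indepMatching nbr S ↔ ∃ u, a ∈ indepArcsAt nbr S u := by
  simp [indepMatching]

theorem card_indepMatching (hinj : ∀ u : V, Function.Injective (nbr u)) (S : Finset V) :
    (indepMatching nbr S).card = 2 * Fintype.card V + S.card := by
  rw [indepMatching, Finset.card_biUnion]
  · simp [card_indepArcsAt hinj, Finset.sum_add_distrib, mul_comm]
  · intro u _ v _ huv
    refine Finset.disjoint_left.2 fun a ha hb => huv ?_
    rw [← fst_fst_of_mem_indepArcsAt ha, fst_fst_of_mem_indepArcsAt hb]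

theorem isEdgeArc_or_isNodeArc_of_mem_indepMatching
    (hadj : ∀ u v : V, G.Adj u v ↔ ∃ i : Fin 3, nbr u i = v) {S : Finset V} {a : Arc V}
    (ha : a ∈ indepMatching nbr S) : IsEdgeArc G a ∨ IsNodeArc nbr a := by
  obtain ⟨u, hu⟩ := mem_indepMatching.1 ha
  rcases mem_indepArcsAt.1 hu with ⟨-, i, rfl⟩ | ⟨-, h⟩
  · exact Or.inl ⟨(hadj _ _).2 ⟨i, rfl⟩, rfl⟩
  · exact Or.inr ⟨u, h⟩

theorem weightM_indepMatching (hadj : ∀ u v : V, G.Adj u v ↔ ∃ i : Fin 3, nbr u i = v)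
    (hinj : ∀ u : V, Function.Injective (nbr u)) (S : Finset V) :
    weightM G nbr (indepMatching nbr S) = 2 * Fintype.card V + S.card := by
  classical
  rw [weightM, Finset.filter_true_of_mem, card_indepMatching hinj]
  exact fun a ha => isEdgeArc_or_isNodeArc_of_mem_indepMatching hadj ha

theorem isControlMatching_indepMatching
    (hadj : ∀ u v : V, G.Adj u v ↔ ∃ i : Fin 3, nbr u i = v)
    (hinj : ∀ u : V, Function.Injective (nbr u)) (S : Finset V) :
    IsControlMatching G nbr (indepMatching nbr S) := by
  have h01 (u : V) : nbr u 0 ≠ nbr u 1 := (hinj u).ne (by decide)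
  have h12 (u : V) : nbr u 1 ≠ nbr u 2 := (hinj u).ne (by decide)
  refine ⟨fun a ha => ?_, fun a ha b hb h => ?_, fun a ha b hb h => ?_⟩
  · rcases isEdgeArc_or_isNodeArc_of_mem_indepMatching hadj ha with h | h
    · exact Or.inl h
    · exact Or.inr (Or.inl h)
  all_goals
    obtain ⟨u, hu⟩ := mem_indepMatching.1 ha
    obtain ⟨v, hv⟩ := mem_indepMatching.1 hb
  · obtain rfl : u = v := by
      rw [← fst_fst_of_mem_indepArcsAt hu, h, fst_fst_of_mem_indepArcsAt hv]
    rcases mem_indepArcsAt.1 hu with ⟨hS, i, rfl⟩ | ⟨hS, rfl | rfl⟩ <;>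
      rcases mem_indepArcsAt.1 hv with ⟨hS', j, rfl⟩ | ⟨hS', rfl | rfl⟩ <;>
      simp_all [edgeArc, nodeArc1, nodeArc2, (h01 u).symm]
  · obtain rfl : u = v := by
      rw [← snd_snd_of_mem_indepArcsAt hu, h, snd_snd_of_mem_indepArcsAt hv]
    rcases mem_indepArcsAt.1 hu with ⟨hS, i, rfl⟩ | ⟨hS, rfl | rfl⟩ <;>
      rcases mem_indepArcsAt.1 hv with ⟨hS', j, rfl⟩ | ⟨hS', rfl | rfl⟩ <;>
      simp_all [edgeArc, nodeArc1, nodeArc2, (h12 u).symm]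

theorem noReversePair_indepMatching
    (hadj : ∀ u v : V, G.Adj u v ↔ ∃ i : Fin 3, nbr u i = v)
    (hinj : ∀ u : V, Function.Injective (nbr u)) {S : Finset V}
    (hS : ∀ a ∈ S, ∀ b ∈ S, ¬ G.Adj a b) : NoReversePair (indepMatching nbr S) := by
  have h01 (u : V) : nbr u 0 ≠ nbr u 1 := (hinj u).ne (by decide)
  have h12 (u : V) : nbr u 1 ≠ nbr u 2 := (hinj u).ne (by decide)
  intro a ha hb
  obtain ⟨u, hu⟩ := mem_indepMatching.1 ha
  obtain ⟨v, hv⟩ := mem_indepMatching.1 hb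
  have h1 := fst_fst_of_mem_indepArcsAt hv
  have h2 := snd_snd_of_mem_indepArcsAt hv
  rcases mem_indepArcsAt.1 hu with ⟨huS, i, rfl⟩ | ⟨-, rfl | rfl⟩
  · obtain rfl : nbr u i = v := h1
    rcases mem_indepArcsAt.1 hv with ⟨hvS, -⟩ | ⟨-, h | h⟩
    · exact hS u huS _ hvS ((hadj _ _).2 ⟨i, rfl⟩)
    · simp only [edgeArc, nodeArc1, Prod.swap, Prod.mk.injEq, true_and, and_true] at h
      exact h01 _ (h.1.symm.trans h.2)
    · simp only [edgeArc, nodeArc2, Prod.swap, Prod.mk.injEq, true_and, and_true] at h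
      exact h12 _ (h.1.symm.trans h.2)
  · exact h01 u (h2.trans h1.symm)
  · exact h12 u (h2.trans h1.symm)

end IndepMatching

theorem weightM_le_OPT {V : Type*} [Finite V] {G : SimpleGraph V} {nbr : V → Fin 3 → V}
    {M : Finset (Arc V)} (hM : IsControlMatching G nbr M) (hrev : NoReversePair M) :
    weightM G nbr M ≤ OPT G nbr := by
  classical
  have := Fintype.ofFinite V
  refine le_csSup ⟨Fintype.card (Arc V), ?_⟩ ⟨M, hM, hrev, rfl⟩
  rintro _ ⟨M', -, -, rfl⟩
  exact Finset.card_le_univ _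

theorem exists_card_eq_indepNum {V : Type*} [Fintype V] (G : SimpleGraph V) :
    ∃ S : Finset V, (∀ a ∈ S, ∀ b ∈ S, ¬ G.Adj a b) ∧ S.card = indepNum G := by
  refine Nat.sSup_mem (s := {k : ℕ | ∃ S : Finset V,
    (∀ a ∈ S, ∀ b ∈ S, ¬ G.Adj a b) ∧ S.card = k}) ⟨0, ∅, by simp, rfl⟩ ⟨Fintype.card V, ?_⟩
  rintro _ ⟨S, -, rfl⟩
  exact Finset.card_le_univ S

/-- For every control matching `M` of `H = f(G)` with no pair of mutually reverse arcs,
`OPT(H) − w(M) ≥ α(G) − |V₃(M)|`. -/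
theorem stmt16 {V : Type*} [Fintype V] [DecidableEq V] (G : SimpleGraph V)
    (nbr : V → Fin 3 → V)
    (hadj : ∀ u v : V, G.Adj u v ↔ ∃ i : Fin 3, nbr u i = v)
    (hinj : ∀ u : V, Function.Injective (nbr u))
    (M : Finset (Arc V)) (hM : IsControlMatching G nbr M) (hrev : NoReversePair M) :
    (indepNum G : ℤ) - ((V3 nbr M).card : ℤ) ≤
      (OPT G nbr : ℤ) - (weightM G nbr M : ℤ) := by
  obtain ⟨S, hS, hcard⟩ := exists_card_eq_indepNum G
  have hlow := weightM_le_OPT (isControlMatching_indepMatching hadj hinj S)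
    (noReversePair_indepMatching hadj hinj hS)
  rw [weightM_indepMatching hadj hinj] at hlow
  have hup := weightM_le hadj hinj hM
  omega
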